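/- Let N ≥ 5 and define w_m(x) = w(x)·∫₀^∞ (1/2)·sgn(x−y)·L_{N−m−2}(y)·w(y) dy for m = 1, 2. Suppose ⟨L_{N−1}, L_{N−2}⟩₁ ≠ 0 and ⟨L_{N−3}, L_{N−4}⟩₁ ≠ 0. Then for each l ∈ {1,2} there exists a unique polynomial P^{II}_{N,l} of degree ≤ N−1 such that ∫₀^∞ P^{II}_{N,l}(x)·x^j·w₀(x) dx = 0 for all 0 ≤ j ≤ N−3, and ∫₀^∞ P^{II}_{N,l}(x)·w_m(x) dx = −2πi·δ_{lm} for m = 1, 2 (δ the Kronecker delta). -/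

import Mathlib

open MeasureTheory Polynomial Set

noncomputable section

/-- The weight `w(x) = e^{−Mx/2}·x^{(M−N−1)/2}·(t−x)^{−1/2}` on `(0,∞)`,
using the principal branch of the complex power. -/
def wC (M N : ℕ) (t : ℂ) (x : ℝ) : ℂ :=
  Complex.exp (-(M : ℂ) * x / 2) * (x : ℂ) ^ (((((M : ℝ) - N - 1) / 2 : ℝ)) : ℂ) *
    (t - x) ^ (-(1 / 2) : ℂ)

/-- The Laguerre weight `w₀(x) = x^{M−N}·e^{−Mx}`. -/
def w0R (M N : ℕ) (x : ℝ) : ℝ := x ^ (M - N) * Real.exp (-(M : ℝ) * x)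

/-- The skew product `⟨f,g⟩₁ = ∫₀^∞∫₀^∞ (1/2)·sgn(x−y)·f(x)·g(y)·w(x)·w(y) dy dx`. -/
def skew1 (M N : ℕ) (t : ℂ) (f g : Polynomial ℂ) : ℂ :=
  ∫ x in Ioi (0 : ℝ), ∫ y in Ioi (0 : ℝ),
    ((Real.sign (x - y) : ℝ) : ℂ) / 2 * f.eval (x : ℂ) * g.eval (y : ℂ) *
      wC M N t x * wC M N t y

/-- The inner product `⟨f,g⟩₂ = ∫₀^∞ f(x)·g(x)·w₀(x) dx`. -/
def inner2C (M N : ℕ) (f g : Polynomial ℂ) : ℂ :=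
  ∫ x in Ioi (0 : ℝ), f.eval (x : ℂ) * g.eval (x : ℂ) * (w0R M N x : ℂ)

/-- `IsLag M N L` says that `L n` is the monic degree-`n` orthogonal polynomial for the
weight `w₀` (the rescaled Laguerre polynomial). -/
def IsLag (M N : ℕ) (L : ℕ → Polynomial ℂ) : Prop :=
  ∀ n, (L n).Monic ∧ (L n).natDegree = n ∧
    ∀ j, j < n → inner2C M N (L n) (Polynomial.X ^ j) = 0

/-- The operator `T(q)(x) = x(t−x)q′(x) +
[(t−2x) − (M/2)x(t−x) + ((M−N−1)/2)(t−x) + x/2]·q(x)`,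
i.e. formally `T(q) = (d/dx)(q·x·(t−x)·w)/w`. -/
def Tq (M N : ℕ) (t : ℂ) (q : Polynomial ℂ) : Polynomial ℂ :=
  Polynomial.X * (Polynomial.C t - Polynomial.X) * Polynomial.derivative q +
    ((Polynomial.C t - 2 * Polynomial.X)
        - Polynomial.C ((M : ℂ) / 2) * (Polynomial.X * (Polynomial.C t - Polynomial.X))
        + Polynomial.C (((M : ℂ) - N - 1) / 2) * (Polynomial.C t - Polynomial.X)
        + Polynomial.C (1 / 2) * Polynomial.X) * q

/-- `ε(f)(x) = ∫₀^∞ (1/2)·sgn(x−y)·f(y) dy`. -/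
def epsC (f : ℝ → ℂ) (x : ℝ) : ℂ :=
  ∫ y in Ioi (0 : ℝ), ((Real.sign (x - y) : ℝ) : ℂ) / 2 * f y

/-- The squared norm `h_{n,0} = ∫₀^∞ L_n(x)²·w₀(x) dx`. -/
def hC (M N : ℕ) (L : ℕ → Polynomial ℂ) (n : ℕ) : ℂ :=
  ∫ x in Ioi (0 : ℝ), (L n).eval (x : ℂ) ^ 2 * (w0R M N x : ℂ)

end

noncomputable section

/-! ### The weight `w` -/

lemma sub_ofReal_mem_slitPlane {t : ℂ} (ht : t.im ≠ 0) (x : ℝ) : t - x ∈ Complex.slitPlane :=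
  Or.inr (by simpa using ht)

lemma sub_ofReal_ne_zero {t : ℂ} (ht : t.im ≠ 0) (x : ℝ) : t - (x : ℂ) ≠ 0 :=
  Complex.slitPlane_ne_zero (sub_ofReal_mem_slitPlane ht x)

lemma wC_eq_ofReal_rpow (M N : ℕ) (t : ℂ) {x : ℝ} (hx : 0 ≤ x) :
    wC M N t x = Complex.exp (-(M : ℂ) * x / 2) * ((x ^ (((M : ℝ) - N - 1) / 2) : ℝ) : ℂ) *
      (t - x) ^ (-(1 / 2) : ℂ) := by
  rw [wC, Complex.ofReal_cpow hx]

lemma half_exponent_nonneg {M N : ℕ} (hNM : N < M) : 0 ≤ ((M : ℝ) - N - 1) / 2 := by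
  have : (N : ℝ) + 1 ≤ M := by exact_mod_cast hNM
  linarith

lemma continuousOn_wC {M N : ℕ} (hNM : N < M) {t : ℂ} (ht : t.im ≠ 0) :
    ContinuousOn (wC M N t) (Ici 0) := by
  refine ContinuousOn.congr (Continuous.continuousOn ?_)
    (fun x hx => wC_eq_ofReal_rpow M N t hx)
  refine Continuous.mul (Continuous.mul (by fun_prop) ?_) ?_
  · exact Complex.continuous_ofReal.comp
      (Real.continuous_rpow_const (half_exponent_nonneg hNM))
  · exact Continuous.cpow (by fun_prop) continuous_const (sub_ofReal_mem_slitPlane ht)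

lemma norm_wC_le {M N : ℕ} {t : ℂ} (ht : t.im ≠ 0) {x : ℝ} (hx : 0 ≤ x) :
    ‖wC M N t x‖ ≤ |t.im| ^ (-(1 / 2) : ℝ) *
      (x ^ (((M : ℝ) - N - 1) / 2) * Real.exp (-((M : ℝ) / 2) * x)) := by
  have h1 : ‖(t - x) ^ (-(1 / 2) : ℂ)‖ ≤ |t.im| ^ (-(1 / 2) : ℝ) := by
    have h : (-(1 / 2) : ℂ) = ((-(1 / 2) : ℝ) : ℂ) := by push_cast; ring
    rw [h, Complex.norm_cpow_real]
    refine Real.rpow_le_rpow_of_nonpos (abs_pos.2 ht) ?_ (by norm_num)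
    simpa using Complex.abs_im_le_norm (t - x)
  have h2 : ‖Complex.exp (-(M : ℂ) * x / 2)‖ = Real.exp (-((M : ℝ) / 2) * x) := by
    have h : -(M : ℂ) * x / 2 = ((-((M : ℝ) / 2) * x : ℝ) : ℂ) := by push_cast; ring
    rw [h, ← Complex.ofReal_exp, Complex.norm_real, Real.norm_eq_abs, Real.abs_exp]
  rw [wC_eq_ofReal_rpow M N t hx, norm_mul, norm_mul, h2, Complex.norm_real,
    Real.norm_of_nonneg (Real.rpow_nonneg hx _)]
  calc _ ≤ Real.exp (-((M : ℝ) / 2) * x) * x ^ (((M : ℝ) - N - 1) / 2) *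
        |t.im| ^ (-(1 / 2) : ℝ) := by gcongr
    _ = _ := by ring

lemma integrableOn_rpow_mul_exp_neg {s b : ℝ} (hs : -1 < s) (hb : 0 < b) :
    IntegrableOn (fun x : ℝ => x ^ s * Real.exp (-b * x)) (Ioi 0) := by
  simpa using integrableOn_rpow_mul_exp_neg_mul_rpow hs one_pos hb

lemma integrableOn_eval_mul_of_pow {u : ℝ → ℂ}
    (h : ∀ n : ℕ, IntegrableOn (fun x : ℝ => (x : ℂ) ^ n * u x) (Ioi 0)) (f : ℂ[X]) :
    IntegrableOn (fun x : ℝ => f.eval (x : ℂ) * u x) (Ioi 0) := by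
  induction f using Polynomial.induction_on' with
  | add p q hp hq =>
    simp only [eval_add, add_mul]
    exact Integrable.add hp hq
  | monomial n a =>
    simp only [eval_monomial, mul_assoc]
    exact Integrable.const_mul (h n) a

lemma integrableOn_eval_mul_wC {M N : ℕ} (hNM : N < M) {t : ℂ} (ht : t.im ≠ 0) (f : ℂ[X]) :
    IntegrableOn (fun x : ℝ => f.eval (x : ℂ) * wC M N t x) (Ioi 0) := by
  refine integrableOn_eval_mul_of_pow (fun n => ?_) f
  have hM : (0 : ℝ) < M := by exact_mod_cast (Nat.zero_le N).trans_lt hNM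
  have hr := half_exponent_nonneg hNM
  have hs : -1 < (n : ℝ) + ((M : ℝ) - N - 1) / 2 := by
    have := n.cast_nonneg (α := ℝ)
    linarith
  refine Integrable.mono' (Integrable.const_mul (integrableOn_rpow_mul_exp_neg hs (half_pos hM))
    (|t.im| ^ (-(1 / 2) : ℝ))) ?_ ?_
  · refine ContinuousOn.aestronglyMeasurable (ContinuousOn.mul (by fun_prop) ?_) measurableSet_Ioi
    exact (continuousOn_wC hNM ht).mono Ioi_subset_Ici_self
  · filter_upwards [ae_restrict_mem measurableSet_Ioi] with x hx
    have hx : 0 < x := hx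
    rw [norm_mul, norm_pow, Complex.norm_real, Real.norm_of_nonneg hx.le, Real.rpow_add hx,
      Real.rpow_natCast]
    refine (mul_le_mul_of_nonneg_left (norm_wC_le ht hx.le) (by positivity)).trans_eq ?_
    ring

lemma hasDerivAt_wC (M N : ℕ) {t : ℂ} (ht : t.im ≠ 0) {x : ℝ} (hx : 0 < x) :
    HasDerivAt (wC M N t)
      (wC M N t x * (-(M : ℂ) / 2 + ((M : ℂ) - N - 1) / 2 / x + 1 / (2 * (t - x)))) x := by
  have hx0 : (x : ℂ) ≠ 0 := by exact_mod_cast hx.ne'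
  have htx := sub_ofReal_ne_zero ht x
  set r : ℂ := (((((M : ℝ) - N - 1) / 2 : ℝ)) : ℂ) with hr
  have he : HasDerivAt (fun z : ℂ => Complex.exp (-(M : ℂ) * z / 2))
      (Complex.exp (-(M : ℂ) * x / 2) * (-(M : ℂ) * 1 / 2)) x :=
    (((hasDerivAt_id (x : ℂ)).const_mul (-(M : ℂ))).div_const 2).cexp
  have hp : HasDerivAt (fun z : ℂ => z ^ r) (r * (x : ℂ) ^ (r - 1) * 1) x :=
    (hasDerivAt_id (x : ℂ)).cpow_const (Complex.ofReal_mem_slitPlane.2 hx)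
  have hq : HasDerivAt (fun z : ℂ => (t - z) ^ (-(1 / 2) : ℂ))
      ((-(1 / 2) : ℂ) * (t - x) ^ ((-(1 / 2) : ℂ) - 1) * (-1)) x :=
    ((hasDerivAt_id (x : ℂ)).const_sub t).cpow_const (sub_ofReal_mem_slitPlane ht x)
  have h := ((he.mul hp).mul hq).comp_ofReal
  refine h.congr_deriv ?_
  have hr' : ((M : ℂ) - N - 1) / 2 = r := by rw [hr]; push_cast; ring
  rw [hr', wC, ← hr, Complex.cpow_sub _ _ hx0, Complex.cpow_sub _ _ htx, Complex.cpow_one,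
    Complex.cpow_one, Pi.mul_apply]
  field_simp

lemma wC_sq {M N : ℕ} (hNM : N < M) {t : ℂ} (ht : t.im ≠ 0) {x : ℝ} (hx : 0 < x) :
    x * (t - x) * (wC M N t x * wC M N t x) = (w0R M N x : ℂ) := by
  have htx := sub_ofReal_ne_zero ht x
  have h1 : (t - x) ^ (-(1 / 2) : ℂ) * (t - x) ^ (-(1 / 2) : ℂ) = (t - x)⁻¹ := by
    rw [← Complex.cpow_add _ _ htx, ← Complex.cpow_neg_one]; norm_num
  have h2 : x * (x ^ (((M : ℝ) - N - 1) / 2) * x ^ (((M : ℝ) - N - 1) / 2)) = x ^ (M - N) := by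
    rw [← Real.rpow_add hx, ← Real.rpow_one_add' hx.le, ← Real.rpow_natCast, Nat.cast_sub hNM.le]
    · congr 1; ring
    · have := half_exponent_nonneg hNM
      linarith
  have h3 : Complex.exp (-(M : ℂ) * x / 2) * Complex.exp (-(M : ℂ) * x / 2) =
      Complex.exp (-(M : ℂ) * x) := by
    rw [← Complex.exp_add]; congr 1; ring
  rw [wC_eq_ofReal_rpow M N t hx.le, w0R, ← h2]
  push_cast
  rw [← h3]
  generalize (t - x) ^ (-(1 / 2) : ℂ) = a at *
  generalize Complex.exp (-(M : ℂ) * x / 2) = b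
  linear_combination
    (x : ℂ) * (t - x) * b ^ 2 * ((x ^ (((M : ℝ) - N - 1) / 2) : ℝ) : ℂ) ^ 2 * h1 +
    (x : ℂ) * b ^ 2 * ((x ^ (((M : ℝ) - N - 1) / 2) : ℝ) : ℂ) ^ 2 * mul_inv_cancel₀ htx

/-! ### The operator `ε` and the skew product -/

lemma measurable_real_sign : Measurable Real.sign :=
  Measurable.ite measurableSet_Iio measurable_const
    (Measurable.ite measurableSet_Ioi measurable_const measurable_const)

lemma norm_sign_div_two_le (x : ℝ) : ‖((Real.sign x : ℝ) : ℂ) / 2‖ ≤ 1 / 2 := by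
  rw [norm_div, Complex.norm_real]
  rcases Real.sign_apply_eq x with h | h | h <;> simp [h]

lemma epsC_eq {u : ℝ → ℂ} (hu : IntegrableOn u (Ioi 0)) {x : ℝ} (hx : 0 ≤ x) :
    epsC u x = (∫ y in Ioi (0 : ℝ), u y) / 2 - ∫ y in Ioi x, u y := by
  have h : ∀ᵐ y ∂volume.restrict (Ioi (0 : ℝ)),
      ((Real.sign (x - y) : ℝ) : ℂ) / 2 * u y = u y / 2 - (Ioi x).indicator u y := by
    have hne : ∀ᵐ y ∂volume.restrict (Ioi (0 : ℝ)), y ≠ x :=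
      ae_restrict_of_ae (by simp [ae_iff])
    filter_upwards [hne] with y hy
    rcases lt_or_gt_of_ne hy with h | h
    · rw [Real.sign_of_pos (sub_pos.2 h), indicator_of_notMem (by simpa using h.le)]
      push_cast; ring
    · rw [Real.sign_of_neg (sub_neg.2 h), indicator_of_mem (by simpa using h)]
      push_cast; ring
  rw [epsC, integral_congr_ae h, integral_sub (hu.div_const 2)
    (Integrable.indicator hu measurableSet_Ioi), integral_div, integral_indicator measurableSet_Ioi,
    Measure.restrict_restrict measurableSet_Ioi,
    inter_eq_left.2 (Ioi_subset_Ioi hx)]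

lemma hasDerivAt_Tq (M N : ℕ) {t : ℂ} (ht : t.im ≠ 0) (q : ℂ[X]) {x : ℝ} (hx : 0 < x) :
    HasDerivAt (fun x : ℝ => (q * X * (C t - X)).eval (x : ℂ) * wC M N t x)
      ((Tq M N t q).eval (x : ℂ) * wC M N t x) x := by
  have hx0 : (x : ℂ) ≠ 0 := by exact_mod_cast hx.ne'
  have htx := sub_ofReal_ne_zero ht x
  refine (((q * X * (C t - X)).hasDerivAt (x : ℂ)).comp_ofReal.mul
    (hasDerivAt_wC M N ht hx)).congr_deriv ?_
  simp only [Tq, derivative_mul, derivative_sub, derivative_C, derivative_X, eval_add, eval_mul,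
    eval_sub, eval_X, eval_C, eval_zero, eval_one, eval_ofNat]
  field_simp
  ring

/-- `ε` inverts the derivative `q ↦ (q·x·(t−x)·w)′ = T(q)·w`. -/
lemma epsC_Tq {M N : ℕ} (hNM : N < M) {t : ℂ} (ht : t.im ≠ 0) (q : ℂ[X]) {x : ℝ} (hx : 0 < x) :
    epsC (fun y => (Tq M N t q).eval (y : ℂ) * wC M N t y) x =
      (q * X * (C t - X)).eval (x : ℂ) * wC M N t x := by
  have hint := integrableOn_eval_mul_wC hNM ht (Tq M N t q)
  have hlim := tendsto_zero_of_hasDerivAt_of_integrableOn_Ioi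
    (fun y hy => hasDerivAt_Tq M N ht q hy) hint (integrableOn_eval_mul_wC hNM ht _)
  have key : ∀ a : ℝ, 0 ≤ a → ∫ y in Ioi a, (Tq M N t q).eval (y : ℂ) * wC M N t y =
      0 - (q * X * (C t - X)).eval (a : ℂ) * wC M N t a := fun a ha =>
    integral_Ioi_of_hasDerivAt_of_tendsto
      (f := fun x : ℝ => (q * X * (C t - X)).eval (x : ℂ) * wC M N t x)
      (ContinuousWithinAt.mul (f := fun x : ℝ => (q * X * (C t - X)).eval (x : ℂ))
        ((Polynomial.continuous _).comp Complex.continuous_ofReal).continuousWithinAt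
        ((continuousOn_wC hNM ht a ha).mono (Ici_subset_Ici.2 ha)))
      (fun y hy => hasDerivAt_Tq M N ht q (lt_of_le_of_lt ha hy))
      (hint.mono_set (Ioi_subset_Ioi ha)) hlim
  rw [epsC_eq hint hx.le, key 0 le_rfl, key x hx.le]
  simp

lemma skew1_eq (M N : ℕ) (t : ℂ) (f g : ℂ[X]) :
    skew1 M N t f g = ∫ x in Ioi (0 : ℝ), f.eval (x : ℂ) * (wC M N t x *
      ∫ y in Ioi (0 : ℝ), ((Real.sign (x - y) : ℝ) : ℂ) / 2 * g.eval (y : ℂ) * wC M N t y) := by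
  rw [skew1]
  congr 1 with x
  rw [← integral_const_mul, ← integral_const_mul]
  congr 1 with y
  ring

lemma integrable_skew_kernel {M N : ℕ} (hNM : N < M) {t : ℂ} (ht : t.im ≠ 0) (f g : ℂ[X]) :
    Integrable (fun z : ℝ × ℝ => ((Real.sign (z.1 - z.2) : ℝ) : ℂ) / 2 * f.eval (z.1 : ℂ) *
      g.eval (z.2 : ℂ) * wC M N t z.1 * wC M N t z.2)
      ((volume.restrict (Ioi 0)).prod (volume.restrict (Ioi 0))) := by
  have h := Integrable.mul_prod (integrableOn_eval_mul_wC hNM ht f)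
    (integrableOn_eval_mul_wC hNM ht g)
  have hm : Measurable fun z : ℝ × ℝ => ((Real.sign (z.1 - z.2) : ℝ) : ℂ) / 2 :=
    (Complex.measurable_ofReal.comp
      (measurable_real_sign.comp (measurable_fst.sub measurable_snd))).div_const 2
  refine (h.bdd_mul hm.aestronglyMeasurable
    (Filter.Eventually.of_forall fun z => norm_sign_div_two_le _)).congr
    (Filter.Eventually.of_forall fun z => ?_)
  ring

lemma skew1_antisymm {M N : ℕ} (hNM : N < M) {t : ℂ} (ht : t.im ≠ 0) (f g : ℂ[X]) :
    skew1 M N t f g = -skew1 M N t g f := by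
  rw [skew1, integral_integral_swap (integrable_skew_kernel hNM ht f g), skew1, ← integral_neg]
  congr 1 with y
  rw [← integral_neg]
  congr 1 with x
  rw [← neg_sub y x, Real.sign_neg]
  push_cast
  ring

lemma skew1_self {M N : ℕ} (hNM : N < M) {t : ℂ} (ht : t.im ≠ 0) (f : ℂ[X]) :
    skew1 M N t f f = 0 :=
  self_eq_neg.1 (skew1_antisymm hNM ht f f)

/-- The skew product as a linear functional of its first argument. -/
def skewLeft {M N : ℕ} (hNM : N < M) {t : ℂ} (ht : t.im ≠ 0) (g : ℂ[X]) : ℂ[X] →ₗ[ℂ] ℂ where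
  toFun f := skew1 M N t f g
  map_add' f₁ f₂ := by
    have h := fun f : ℂ[X] => (integrable_skew_kernel hNM ht f g).integral_prod_left
    simp only [skew1_eq, eval_add, add_mul]
    refine integral_add ((h f₁).congr (Filter.Eventually.of_forall fun x => ?_))
      ((h f₂).congr (Filter.Eventually.of_forall fun x => ?_)) <;>
    · simp only [← integral_const_mul]
      congr 1 with y
      ring
  map_smul' c f := by
    simp only [skew1_eq, eval_smul, smul_eq_mul, mul_assoc, RingHom.id_apply, integral_const_mul]

@[simp]
lemma skewLeft_apply {M N : ℕ} (hNM : N < M) {t : ℂ} (ht : t.im ≠ 0) (f g : ℂ[X]) :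
    skewLeft hNM ht g f = skew1 M N t f g := rfl

lemma skew1_add_left {M N : ℕ} (hNM : N < M) {t : ℂ} (ht : t.im ≠ 0) (f₁ f₂ g : ℂ[X]) :
    skew1 M N t (f₁ + f₂) g = skew1 M N t f₁ g + skew1 M N t f₂ g :=
  (skewLeft hNM ht g).map_add f₁ f₂

lemma skew1_smul_left {M N : ℕ} (hNM : N < M) {t : ℂ} (ht : t.im ≠ 0) (c : ℂ) (f g : ℂ[X]) :
    skew1 M N t (c • f) g = c * skew1 M N t f g :=
  (skewLeft hNM ht g).map_smul c f

lemma skew1_zero_left {M N : ℕ} (hNM : N < M) {t : ℂ} (ht : t.im ≠ 0) (g : ℂ[X]) :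
    skew1 M N t 0 g = 0 :=
  (skewLeft hNM ht g).map_zero

lemma skew1_Tq {M N : ℕ} (hNM : N < M) {t : ℂ} (ht : t.im ≠ 0) (f q : ℂ[X]) :
    skew1 M N t f (Tq M N t q) = inner2C M N f q := by
  rw [skew1_eq, inner2C]
  refine setIntegral_congr_fun measurableSet_Ioi fun x hx => ?_
  have h := epsC_Tq hNM ht q hx
  simp only [epsC, ← mul_assoc] at h
  simp only [h, ← wC_sq hNM ht hx, eval_mul, eval_sub, eval_X, eval_C]
  ring

/-! ### The inner product with weight `w₀` -/

lemma integrableOn_eval_mul_w0R {M N : ℕ} (hNM : N < M) (f : ℂ[X]) :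
    IntegrableOn (fun x : ℝ => f.eval (x : ℂ) * (w0R M N x : ℂ)) (Ioi 0) := by
  refine integrableOn_eval_mul_of_pow (fun n => ?_) f
  have hM : (0 : ℝ) < M := by exact_mod_cast (Nat.zero_le N).trans_lt hNM
  have hs : -1 < ((n + (M - N) : ℕ) : ℝ) := by
    have := (n + (M - N)).cast_nonneg (α := ℝ)
    linarith
  refine Integrable.congr (Integrable.ofReal (𝕜 := ℂ) (integrableOn_rpow_mul_exp_neg hs hM))
    (Filter.Eventually.of_forall fun x => ?_)
  simp only [Real.rpow_natCast, w0R, pow_add]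
  simp [mul_assoc]

/-- The inner product as a linear functional of its first argument. -/
def innerLeft {M N : ℕ} (hNM : N < M) (g : ℂ[X]) : ℂ[X] →ₗ[ℂ] ℂ where
  toFun f := inner2C M N f g
  map_add' f₁ f₂ := by
    have h := fun f : ℂ[X] => integrableOn_eval_mul_w0R hNM (f * g)
    simp only [eval_mul] at h
    simp only [inner2C, eval_add, add_mul]
    exact integral_add (h f₁) (h f₂)
  map_smul' c f := by
    simp only [inner2C, eval_smul, smul_eq_mul, mul_assoc, RingHom.id_apply, integral_const_mul]

@[simp]
lemma innerLeft_apply {M N : ℕ} (hNM : N < M) (f g : ℂ[X]) :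
    innerLeft hNM g f = inner2C M N f g := rfl

lemma inner2C_comm (M N : ℕ) (f g : ℂ[X]) : inner2C M N f g = inner2C M N g f := by
  simp only [inner2C, mul_comm (f.eval _)]

/-- Orthogonality to the monomials of degree `< n` gives orthogonality to all polynomials of
degree `< n`. -/
lemma inner2C_eq_zero_of_degree_lt {M N : ℕ} (hNM : N < M) {f g : ℂ[X]} {n : ℕ}
    (h : ∀ j < n, inner2C M N f (X ^ j) = 0) (hg : g.degree < n) : inner2C M N f g = 0 := by
  rw [inner2C_comm, ← innerLeft_apply hNM]
  have hle : degreeLT ℂ n ≤ LinearMap.ker (innerLeft hNM f) := by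
    rw [degreeLT_eq_span_X_pow, Submodule.span_le]
    intro p hp
    obtain ⟨j, hj, rfl⟩ : ∃ j < n, X ^ j = p := by simpa using hp
    simpa [inner2C_comm M N (X ^ j)] using h j hj
  exact hle (mem_degreeLT.2 hg)

lemma eq_zero_of_inner2C_conj_eq_zero {M N : ℕ} (hNM : N < M) {f : ℂ[X]}
    (h : inner2C M N f (f.map (starRingEnd ℂ)) = 0) : f = 0 := by
  have hpt : ∀ x : ℝ, f.eval (x : ℂ) * (f.map (starRingEnd ℂ)).eval (x : ℂ) * (w0R M N x : ℂ) =
      ((‖f.eval (x : ℂ)‖ ^ 2 * w0R M N x : ℝ) : ℂ) := fun x => by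
    have hc : (f.map (starRingEnd ℂ)).eval (x : ℂ) = starRingEnd ℂ (f.eval (x : ℂ)) := by
      conv_lhs => rw [← Complex.conj_ofReal x]
      rw [eval_map, eval₂_hom]
    rw [hc, Complex.mul_conj, Complex.normSq_eq_norm_sq]
    push_cast; ring
  have hi : IntegrableOn (fun x : ℝ => ‖f.eval (x : ℂ)‖ ^ 2 * w0R M N x) (Ioi 0) := by
    have := integrableOn_eval_mul_w0R hNM (f * f.map (starRingEnd ℂ))
    simp only [eval_mul, hpt] at this
    exact Integrable.re this
  simp only [inner2C, hpt, integral_complex_ofReal, Complex.ofReal_eq_zero] at h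
  have hpos : ∀ x ∈ Ioi (0 : ℝ), 0 < w0R M N x := fun x hx =>
    mul_pos (pow_pos hx _) (Real.exp_pos _)
  rw [integral_eq_zero_iff_of_nonneg_ae _ hi] at h
  swap
  · filter_upwards [ae_restrict_mem measurableSet_Ioi] with x hx
    exact mul_nonneg (sq_nonneg _) (hpos x hx).le
  by_contra hf
  have hfin : {x : ℝ | f.eval (x : ℂ) = 0}.Finite := by
    refine (Set.Finite.preimage Complex.ofReal_injective.injOn
      (f.roots.toFinset.finite_toSet)).subset fun x hx => ?_
    simpa [hf] using hx
  have hroot : ∀ᵐ x ∂volume.restrict (Ioi (0 : ℝ)), x ∉ {x : ℝ | f.eval (x : ℂ) = 0} :=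
    ae_restrict_of_ae (measure_eq_zero_iff_ae_notMem.1 (hfin.measure_zero volume))
  have hfalse : ∀ᵐ x ∂volume.restrict (Ioi (0 : ℝ)), False := by
    filter_upwards [h, hroot, ae_restrict_mem measurableSet_Ioi] with x h0 h1 h2
    rcases mul_eq_zero.1 h0 with h0 | h0
    · exact h1 (by simpa using h0)
    · exact (hpos x h2).ne' h0
  rw [Filter.eventually_false_iff_eq_bot, ae_eq_bot, Measure.restrict_eq_zero] at hfalse
  simp at hfalse

lemma eq_zero_of_degree_lt_of_inner2C {M N : ℕ} (hNM : N < M) {f : ℂ[X]} {n : ℕ}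
    (hf : f.degree < n) (h : ∀ j < n, inner2C M N f (X ^ j) = 0) : f = 0 :=
  eq_zero_of_inner2C_conj_eq_zero hNM
    (inner2C_eq_zero_of_degree_lt hNM h (by rwa [degree_map]))

/-! ### Degrees -/

lemma natDegree_X_mul_C_sub_X_mul_derivative_le (t : ℂ) (q : ℂ[X]) :
    (X * (C t - X) * derivative q).natDegree ≤ q.natDegree + 1 := by
  rcases Nat.eq_zero_or_pos q.natDegree with h | h
  · simp [derivative_of_natDegree_zero h]
  · have h2 : (X * (C t - X)).natDegree ≤ 2 := by compute_degree
    have := natDegree_derivative_le q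
    exact natDegree_mul_le.trans (by omega)

lemma coeff_Tq (M N : ℕ) (t : ℂ) (q : ℂ[X]) :
    (Tq M N t q).coeff (q.natDegree + 2) = (M : ℂ) / 2 * q.leadingCoeff := by
  rw [Tq, coeff_add, coeff_eq_zero_of_natDegree_lt
    (Nat.lt_of_le_of_lt (natDegree_X_mul_C_sub_X_mul_derivative_le t q) (by omega)), zero_add,
    add_comm q.natDegree, coeff_mul_add_eq_of_natDegree_le (by compute_degree) le_rfl]
  congr 1
  compute_degree!

lemma natDegree_Tq_le (M N : ℕ) (t : ℂ) (q : ℂ[X]) :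
    (Tq M N t q).natDegree ≤ q.natDegree + 2 := by
  refine natDegree_add_le_of_degree_le
    ((natDegree_X_mul_C_sub_X_mul_derivative_le t q).trans (by omega)) ?_
  rw [add_comm q.natDegree]
  exact natDegree_mul_le_of_le (by compute_degree) le_rfl

lemma natDegree_Tq {M N : ℕ} (hM : M ≠ 0) (t : ℂ) {q : ℂ[X]} (hq : q ≠ 0) :
    (Tq M N t q).natDegree = q.natDegree + 2 :=
  le_antisymm (natDegree_Tq_le M N t q)
    (le_natDegree_of_ne_zero (by rw [coeff_Tq]; simp [hM, hq]))

/-- `T` as a linear map. -/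
def TqLinear (M N : ℕ) (t : ℂ) : ℂ[X] →ₗ[ℂ] ℂ[X] where
  toFun := Tq M N t
  map_add' p q := by simp only [Tq, derivative_add]; ring
  map_smul' c q := by
    simp only [Tq, derivative_smul, RingHom.id_apply]
    simp only [smul_eq_C_mul]
    ring

@[simp]
lemma TqLinear_apply (M N : ℕ) (t : ℂ) (q : ℂ[X]) : TqLinear M N t q = Tq M N t q := rfl

instance finiteDimensional_degreeLT (n : ℕ) : FiniteDimensional ℂ (degreeLT ℂ n) :=
  (degreeLTEquiv ℂ n).symm.finiteDimensional

lemma finrank_degreeLT (n : ℕ) : Module.finrank ℂ (degreeLT ℂ n) = n := by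
  rw [(degreeLTEquiv ℂ n).finrank_eq, Module.finrank_fin_fun]

/-- A polynomial of degree `< n + 2` that is orthogonal to all polynomials of degree `< n` is a
combination of the orthogonal polynomials of degrees `n` and `n + 1`. -/
lemma IsLag.eq_combination {M N : ℕ} (hNM : N < M) {L : ℕ → ℂ[X]} (hL : IsLag M N L) {n : ℕ}
    {D : ℂ[X]} (hD : D.degree < (n + 2 : ℕ)) (h : ∀ j < n, inner2C M N D (X ^ j) = 0) :
    ∃ a b : ℂ, D = a • L (n + 1) + b • L n := by
  have hlead : ∀ k, (L k).coeff k = 1 := fun k => by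
    simpa [Monic, leadingCoeff, (hL k).2.1] using (hL k).1
  have hhigh : ∀ k m, k < m → (L k).coeff m = 0 := fun k m hkm =>
    coeff_eq_zero_of_natDegree_lt (by rwa [(hL k).2.1])
  set a := D.coeff (n + 1) with ha
  set b := D.coeff n - a * (L (n + 1)).coeff n with hb
  refine ⟨a, b, ?_⟩
  rw [← sub_eq_zero]
  refine eq_zero_of_degree_lt_of_inner2C hNM (n := n) ?_ fun j hj => ?_
  · rw [degree_lt_iff_coeff_zero]
    intro m hm
    simp only [coeff_sub, coeff_add, coeff_smul, smul_eq_mul]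
    rcases hm.eq_or_lt with rfl | hm
    · rw [hlead, hb]; ring
    rcases (Nat.succ_le_of_lt hm).eq_or_lt with rfl | hm'
    · rw [hlead, hhigh _ _ hm, ha]; simp
    · rw [hhigh _ _ hm, hhigh _ _ hm', (degree_lt_iff_coeff_zero D (n + 2)).1 hD m hm']; simp
  · rw [← innerLeft_apply hNM, map_sub, map_add, map_smul, map_smul]
    simp [h j hj, (hL n).2.2 j hj, (hL (n + 1)).2.2 j (by omega)]

/-- If `⟨L_{n+2}, L_{n+1}⟩₁ ≠ 0`, then `L_{n+2}`, `L_{n+1}` and the image under `T` of the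
polynomials of degree `< n + 3` together span all polynomials of degree `< n + 5`. -/
lemma IsLag.exists_eq_add_Tq {M N : ℕ} (hNM : N < M) {t : ℂ} (ht : t.im ≠ 0) {L : ℕ → ℂ[X]}
    (hL : IsLag M N L) {n : ℕ} (h : skew1 M N t (L (n + 2)) (L (n + 1)) ≠ 0) {g : ℂ[X]}
    (hg : g.degree < (n + 5 : ℕ)) :
    ∃ (a b : ℂ) (q : ℂ[X]), q.degree < (n + 3 : ℕ) ∧
      g = a • L (n + 2) + b • L (n + 1) + Tq M N t q := by
  have hM : M ≠ 0 := by omega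
  have hdeg : ∀ k < n + 5, (L k).degree < (n + 5 : ℕ) := fun k hk => by
    rw [degree_eq_natDegree (hL k).1.ne_zero, (hL k).2.1]; exact_mod_cast hk
  let Φ₀ : (ℂ × ℂ) × degreeLT ℂ (n + 3) →ₗ[ℂ] ℂ[X] :=
    ((LinearMap.toSpanSingleton ℂ _ (L (n + 2))).coprod
      (LinearMap.toSpanSingleton ℂ _ (L (n + 1)))).coprod
      ((TqLinear M N t).comp (degreeLT ℂ (n + 3)).subtype)
  have hΦ₀ : ∀ v, Φ₀ v = v.1.1 • L (n + 2) + v.1.2 • L (n + 1) + Tq M N t v.2 := fun v => by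
    simp [Φ₀]
  have hmem : ∀ v, Φ₀ v ∈ degreeLT ℂ (n + 5) := fun v => by
    rw [hΦ₀]
    refine add_mem (add_mem (Submodule.smul_mem _ _ (mem_degreeLT.2 (hdeg _ (by omega))))
      (Submodule.smul_mem _ _ (mem_degreeLT.2 (hdeg _ (by omega))))) ?_
    by_cases hq : (v.2 : ℂ[X]) = 0
    · rw [hq, ← TqLinear_apply, map_zero]; exact zero_mem _
    have hlt := (natDegree_lt_iff_degree_lt hq).2 (mem_degreeLT.1 v.2.2)
    refine mem_degreeLT.2 (degree_le_natDegree.trans_lt ?_)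
    rw [natDegree_Tq hM t hq]
    exact_mod_cast (by omega)
  have hinj : Function.Injective (Φ₀.codRestrict _ hmem) := by
    rw [injective_iff_map_eq_zero]
    rintro ⟨⟨a, b⟩, q⟩ hv
    replace hv : a • L (n + 2) + b • L (n + 1) + Tq M N t q = 0 := by
      rw [← hΦ₀ ((a, b), q)]; exact congrArg Subtype.val hv
    have hqdeg : (q : ℂ[X]).degree < (n + 1 : ℕ) := by
      by_cases hq : (q : ℂ[X]) = 0
      · rw [hq, degree_zero]; exact WithBot.bot_lt_coe _
      refine (natDegree_lt_iff_degree_lt hq).1 ?_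
      have h1 : (Tq M N t q).natDegree ≤ n + 2 := by
        rw [← neg_eq_of_add_eq_zero_right hv, natDegree_neg]
        exact natDegree_add_le_of_degree_le ((natDegree_smul_le _ _).trans (hL _).2.1.le)
          ((natDegree_smul_le _ _).trans ((hL _).2.1.le.trans (by omega)))
      rw [natDegree_Tq hM t hq] at h1
      omega
    have hT : ∀ k, n + 1 ≤ k → skew1 M N t (Tq M N t q) (L k) = 0 := fun k hk => by
      rw [skew1_antisymm hNM ht, skew1_Tq hNM ht, inner2C_eq_zero_of_degree_lt hNM (hL k).2.2
        (hqdeg.trans_le (by exact_mod_cast hk)), neg_zero]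
    have ha : a = 0 := by
      have := congrArg (skew1 M N t · (L (n + 1))) hv
      simpa [skew1_add_left hNM ht, skew1_smul_left hNM ht, skew1_zero_left hNM ht,
        skew1_self hNM ht, hT, h] using this
    have hb : b = 0 := by
      have := congrArg (skew1 M N t · (L (n + 2))) hv
      simpa [skew1_add_left hNM ht, skew1_smul_left hNM ht, skew1_zero_left hNM ht,
        skew1_self hNM ht, hT, skew1_antisymm hNM ht (L (n + 1)), h] using this
    have hq : (q : ℂ[X]) = 0 := by
      by_contra hq
      have := natDegree_Tq (N := N) hM t hq
      simp [ha, hb] at hv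
      simp [hv] at this
    simp [ha, hb, Subtype.ext_iff, hq]
  have hsurj := (LinearMap.injective_iff_surjective_of_finrank_eq_finrank
    (by simp [Module.finrank_prod, finrank_degreeLT]; omega)).1 hinj
  obtain ⟨v, hv⟩ := hsurj ⟨g, mem_degreeLT.2 hg⟩
  exact ⟨v.1.1, v.1.2, v.2, mem_degreeLT.1 v.2.2,
    by rw [← hΦ₀]; exact (congrArg Subtype.val hv).symm⟩

/-- Nondegeneracy of the homogeneous type II problem. -/
lemma IsLag.eq_zero_of_orthogonal {M N : ℕ} (hNM : N < M) {t : ℂ} (ht : t.im ≠ 0) {L : ℕ → ℂ[X]}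
    (hL : IsLag M N L) {n : ℕ} (h1 : skew1 M N t (L (n + 4)) (L (n + 3)) ≠ 0)
    (h2 : skew1 M N t (L (n + 2)) (L (n + 1)) ≠ 0) {D : ℂ[X]} (hD : D.degree < (n + 5 : ℕ))
    (horth : ∀ j < n + 3, inner2C M N D (X ^ j) = 0)
    (hs1 : skew1 M N t D (L (n + 2)) = 0) (hs2 : skew1 M N t D (L (n + 1)) = 0) : D = 0 := by
  have hall : ∀ g : ℂ[X], g.degree < (n + 5 : ℕ) → skew1 M N t g D = 0 := fun g hg => by
    obtain ⟨a, b, q, hq, rfl⟩ := hL.exists_eq_add_Tq hNM ht h2 hg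
    have hT : skew1 M N t (Tq M N t q) D = 0 := by
      rw [skew1_antisymm hNM ht, skew1_Tq hNM ht, inner2C_eq_zero_of_degree_lt hNM horth hq,
        neg_zero]
    simp [skew1_add_left hNM ht, skew1_smul_left hNM ht, skew1_antisymm hNM ht (L _) D,
      hs1, hs2, hT]
  have hdeg : ∀ k < n + 5, (L k).degree < (n + 5 : ℕ) := fun k hk => by
    rw [degree_eq_natDegree (hL k).1.ne_zero, (hL k).2.1]; exact_mod_cast hk
  have hall' : ∀ k < n + 5, skew1 M N t D (L k) = 0 := fun k hk => by
    rw [skew1_antisymm hNM ht, hall _ (hdeg k hk), neg_zero]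
  obtain ⟨a, b, hab⟩ := hL.eq_combination hNM hD horth
  have ha : a = 0 := by
    have := hall' (n + 3) (by omega)
    rw [hab, skew1_add_left hNM ht, skew1_smul_left hNM ht, skew1_smul_left hNM ht] at this
    simpa [skew1_self hNM ht, h1] using this
  have hb : b = 0 := by
    have := hall' (n + 4) (by omega)
    rw [hab, skew1_add_left hNM ht, skew1_smul_left hNM ht, skew1_smul_left hNM ht] at this
    simpa [skew1_self hNM ht, skew1_antisymm hNM ht (L (n + 3)), h1] using this
  simpa [ha, hb] using hab

/-- The type II problem with arbitrary data is uniquely solvable. -/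
lemma IsLag.existsUnique_typeII {M N : ℕ} (hNM : N < M) {t : ℂ} (ht : t.im ≠ 0) {L : ℕ → ℂ[X]}
    (hL : IsLag M N L) {n : ℕ} (h1 : skew1 M N t (L (n + 4)) (L (n + 3)) ≠ 0)
    (h2 : skew1 M N t (L (n + 2)) (L (n + 1)) ≠ 0) (c₁ c₂ : ℂ) :
    ∃! P : ℂ[X], P.degree < (n + 5 : ℕ) ∧ (∀ j < n + 3, inner2C M N P (X ^ j) = 0) ∧
      skew1 M N t P (L (n + 2)) = c₁ ∧ skew1 M N t P (L (n + 1)) = c₂ := by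
  let Ψ : degreeLT ℂ (n + 5) →ₗ[ℂ] (Fin (n + 3) → ℂ) × ℂ × ℂ :=
    ((LinearMap.pi fun j : Fin (n + 3) => innerLeft hNM (X ^ (j : ℕ))).prod
      ((skewLeft hNM ht (L (n + 2))).prod (skewLeft hNM ht (L (n + 1))))).comp
      (degreeLT ℂ (n + 5)).subtype
  have hΨ : ∀ P c c₁ c₂, Ψ P = (c, c₁, c₂) ↔
      (∀ j : Fin (n + 3), inner2C M N P (X ^ (j : ℕ)) = c j) ∧
      skew1 M N t P (L (n + 2)) = c₁ ∧ skew1 M N t P (L (n + 1)) = c₂ := fun P c c₁ c₂ => by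
    simp [Ψ, funext_iff]
  have hinj : Function.Injective Ψ := by
    rw [injective_iff_map_eq_zero]
    intro D hD
    obtain ⟨ho, hs1, hs2⟩ := (hΨ D 0 0 0).1 hD
    exact Subtype.ext (hL.eq_zero_of_orthogonal hNM ht h1 h2 (mem_degreeLT.1 D.2)
      (fun j hj => ho ⟨j, hj⟩) hs1 hs2)
  have hsurj := (LinearMap.injective_iff_surjective_of_finrank_eq_finrank
    (by simp [Module.finrank_prod, finrank_degreeLT])).1 hinj
  obtain ⟨P, hP⟩ := hsurj (0, c₁, c₂)
  obtain ⟨ho, hs⟩ := (hΨ P 0 c₁ c₂).1 hP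
  refine ⟨P, ⟨mem_degreeLT.1 P.2, fun j hj => ho ⟨j, hj⟩, hs⟩, ?_⟩
  rintro Q ⟨hQ, hQo, hQs⟩
  exact congrArg Subtype.val (hinj (a₁ := ⟨Q, mem_degreeLT.2 hQ⟩)
    (((hΨ ⟨Q, mem_degreeLT.2 hQ⟩ 0 c₁ c₂).2 ⟨fun j => hQo j j.2, hQs⟩).trans hP.symm))

end

/-- Let `N ≥ 5`, `w_m(x) = w(x)·∫₀^∞ (1/2)·sgn(x−y)·L_{N−m−2}(y)·w(y) dy`
for `m = 1, 2`, and suppose `⟨L_{N−1},L_{N−2}⟩₁ ≠ 0` and `⟨L_{N−3},L_{N−4}⟩₁ ≠ 0`.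
Then for each `l ∈ {1,2}` there is a unique polynomial `P = P^{II}_{N,l}` of degree
`≤ N−1` with `∫₀^∞ P·x^j·w₀ dx = 0` for `0 ≤ j ≤ N−3` and
`∫₀^∞ P·w_m dx = −2πi·δ_{lm}` for `m = 1, 2`. -/
theorem stmt_10 (M N : ℕ) (hN : 5 ≤ N) (hNM : N < M) (t : ℂ) (ht : t.im ≠ 0)
    (L : ℕ → Polynomial ℂ) (hL : IsLag M N L)
    (h1 : skew1 M N t (L (N - 1)) (L (N - 2)) ≠ 0)
    (h2 : skew1 M N t (L (N - 3)) (L (N - 4)) ≠ 0)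
    (l : ℕ) (hl : l = 1 ∨ l = 2) :
    ∃! P : Polynomial ℂ, P.natDegree ≤ N - 1 ∧
      (∀ j, j ≤ N - 3 →
        (∫ x in Ioi (0 : ℝ), P.eval (x : ℂ) * (x : ℂ) ^ j * (w0R M N x : ℂ)) = 0) ∧
      (∀ m, m = 1 ∨ m = 2 →
        (∫ x in Ioi (0 : ℝ), P.eval (x : ℂ) *
            (wC M N t x * ∫ y in Ioi (0 : ℝ),
              ((Real.sign (x - y) : ℝ) : ℂ) / 2 * (L (N - m - 2)).eval (y : ℂ) *
                wC M N t y))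
          = if l = m then -(2 * Real.pi * Complex.I) else 0) := by
  obtain ⟨n, rfl⟩ : ∃ n, N = n + 5 := ⟨N - 5, by omega⟩
  refine (existsUnique_congr fun P => ?_).1 (hL.existsUnique_typeII (n := n) hNM ht h1 h2
    (if l = 1 then -(2 * Real.pi * Complex.I) else 0)
    (if l = 2 then -(2 * Real.pi * Complex.I) else 0))
  refine and_congr ?_ (and_congr ?_ ?_)
  · rw [← mem_degreeLT, ← Nat.lt_succ_iff]
    refine ⟨fun h => ?_, fun h => mem_degreeLT.2 (degree_le_natDegree.trans_lt ?_)⟩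
    · by_cases hP : P = 0
      · simp [hP]
      · exact (natDegree_lt_iff_degree_lt hP).2 (mem_degreeLT.1 h)
    · exact_mod_cast h
  · refine forall_congr' fun j => imp_congr (by omega) ?_
    simp [inner2C]
  · simp only [← skew1_eq, forall_eq_or_imp, forall_eq]
    rfl
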